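/- Let Ω be a quaternionic hyperconvex domain in ℍⁿ and suppose K ⊂ Ω is compact and is the union of a family of closed balls. Then u_{K,Ω} = u*_{K,Ω} and u_{K,Ω} is continuous in Ω. Moreover, for concentric balls with center a and radii r < R, the relatively extremal function of the closed ball B̄(a,r) in the open ball B(a,R) is given explicitly by u_{B̄(a,r),B(a,R)}(q) = max{−1, (R^{−2} − ‖q−a‖^{−2})/(r^{−2} − R^{−2})}. -/

import Mathlib

/- ## Preliminaries: quaternionic pluripotential theory -/

open MeasureTheory Filter Topology
open scoped Quaternion ENNReal

noncomputable section

/-- Borel measurable structure on the quaternions. -/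
instance : MeasurableSpace ℍ := borel ℍ
instance : BorelSpace ℍ := ⟨rfl⟩

/-- Lebesgue measure on the quaternions, transported from `ℝ⁴`. -/
instance : MeasureSpace ℍ :=
  ⟨Measure.map Quaternion.linearIsometryEquivTuple.symm volume⟩

instance : SigmaFinite (volume : Measure ℍ) := by
  have h : (volume : Measure ℍ) =
      Measure.map
        (Quaternion.linearIsometryEquivTuple.toHomeomorph.symm.toMeasurableEquiv) volume := rfl
  rw [h]
  exact MeasurableEquiv.sigmaFinite_map _

/-- `n`-dimensional quaternionic space `ℍⁿ`. -/
abbrev Hn (n : ℕ) := Fin n → ℍ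

/-! ### Subharmonic and quaternionic plurisubharmonic functions -/

/-- Second directional derivative. -/
def secondDeriv (h : ℍ → ℝ) (x v : ℍ) : ℝ :=
  fderiv ℝ (fun y => fderiv ℝ h y v) x v

/-- The Laplacian on `ℍ ≅ ℝ⁴`. -/
def lapQ (h : ℍ → ℝ) (x : ℍ) : ℝ :=
  secondDeriv h x 1 + secondDeriv h x ⟨0, 1, 0, 0⟩ +
    secondDeriv h x ⟨0, 0, 1, 0⟩ + secondDeriv h x ⟨0, 0, 0, 1⟩

/-- A real-valued function is harmonic on a set if it is `C²` there with vanishing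
Laplacian. -/
def HarmonicOnQ (h : ℍ → ℝ) (s : Set ℍ) : Prop :=
  ContDiffOn ℝ 2 h s ∧ ∀ x ∈ s, lapQ h x = 0

/-- A `[-∞,∞)`-valued function is subharmonic on `s ⊆ ℍ ≅ ℝ⁴` (in the usual sense) if it is
upper semicontinuous and lies below every harmonic majorant on closed balls. -/
def SubharmonicOn (u : ℍ → EReal) (s : Set ℍ) : Prop :=
  UpperSemicontinuousOn u s ∧ (∀ x ∈ s, u x ≠ ⊤) ∧
  ∀ (x : ℍ) (r : ℝ), 0 < r → Metric.closedBall x r ⊆ s →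
    ∀ h : ℍ → ℝ, ContinuousOn h (Metric.closedBall x r) →
      HarmonicOnQ h (Metric.ball x r) →
      (∀ y ∈ Metric.sphere x r, u y ≤ (h y : EReal)) →
      ∀ y ∈ Metric.closedBall x r, u y ≤ (h y : EReal)

/-- The right quaternionic line through `a` with direction `b`. -/
def qLine {n : ℕ} (a b : Hn n) (t : ℍ) : Hn n := fun k => a k + b k * t

/-- A `[-∞,∞)`-valued function is quaternionic plurisubharmonic on `Ω` if it is upper
semicontinuous on `Ω` and its restriction to every right quaternionic line is subharmonic. -/
def QPSH {n : ℕ} (u : Hn n → EReal) (Ω : Set (Hn n)) : Prop :=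
  UpperSemicontinuousOn u Ω ∧ (∀ q ∈ Ω, u q ≠ ⊤) ∧
  ∀ a b : Hn n, SubharmonicOn (fun t => u (qLine a b t)) {t : ℍ | qLine a b t ∈ Ω}

/-- Quaternionic plurisubharmonicity for real-valued functions. -/
def QPSHr {n : ℕ} (u : Hn n → ℝ) (Ω : Set (Hn n)) : Prop :=
  QPSH (fun q => (u q : EReal)) Ω

/-- A quaternionic hyperconvex domain: open, bounded, connected, admitting a negative
plurisubharmonic exhaustion function. -/
def QHyperconvex {n : ℕ} (Ω : Set (Hn n)) : Prop :=
  IsOpen Ω ∧ Bornology.IsBounded Ω ∧ IsConnected Ω ∧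
  ∃ ρ : Hn n → EReal, QPSH ρ Ω ∧ (∀ q ∈ Ω, ρ q < 0) ∧
    ∀ c : ℝ, c < 0 →
      IsCompact (closure {q | q ∈ Ω ∧ ρ q < (c : EReal)}) ∧
      closure {q | q ∈ Ω ∧ ρ q < (c : EReal)} ⊆ Ω

/-! ### The quaternionic Monge–Ampère operator on smooth functions -/

/-- The four quaternionic units. -/
def unitQ : Fin 4 → ℍ
  | 0 => 1
  | 1 => ⟨0, 1, 0, 0⟩
  | 2 => ⟨0, 0, 1, 0⟩
  | 3 => ⟨0, 0, 0, 1⟩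

/-- The coordinate direction `x_{4l+m}` in `ℍⁿ ≅ ℝ^{4n}`. -/
def dirQ {n : ℕ} (l : Fin n) (m : Fin 4) : Hn n := fun k => if k = l then unitQ m else 0

/-- Real partial derivative of a complex-valued function in the direction `v`. -/
def pdQ {n : ℕ} (v : Hn n) (f : Hn n → ℂ) (q : Hn n) : ℂ := fderiv ℝ f q v

/-- The first-order differential operators `∇_{jα}`, `j < 2n`, `α < 2`. -/
def nablaQ {n : ℕ} (j : Fin (2 * n)) (α : Fin 2) (f : Hn n → ℂ) (q : Hn n) : ℂ :=
  let l : Fin n := ⟨j.val / 2, by omega⟩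
  if j.val % 2 = 0 then
    (if α = 0 then pdQ (dirQ l 0) f q + Complex.I * pdQ (dirQ l 1) f q
     else - pdQ (dirQ l 2) f q - Complex.I * pdQ (dirQ l 3) f q)
  else
    (if α = 0 then pdQ (dirQ l 2) f q - Complex.I * pdQ (dirQ l 3) f q
     else pdQ (dirQ l 0) f q - Complex.I * pdQ (dirQ l 1) f q)

/-- The Baston coefficients `Δ_{ij} u = ½(∇_{i0}∇_{j1}u − ∇_{i1}∇_{j0}u)`. -/
def bastonQ {n : ℕ} (i j : Fin (2 * n)) (u : Hn n → ℝ) (q : Hn n) : ℂ :=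
  (1 / 2 : ℂ) * (nablaQ i 0 (fun x => nablaQ j 1 (fun y => (u y : ℂ)) x) q -
    nablaQ i 1 (fun x => nablaQ j 0 (fun y => (u y : ℂ)) x) q)

/-- The coefficients of `γ(u,v) = ½(d₀u∧d₁v − d₁u∧d₀v)`. -/
def gammaQ {n : ℕ} (i j : Fin (2 * n)) (u v : Hn n → ℝ) (q : Hn n) : ℂ :=
  (1 / 2 : ℂ) * (nablaQ i 0 (fun y => (u y : ℂ)) q * nablaQ j 1 (fun y => (v y : ℂ)) q -
    nablaQ i 1 (fun y => (u y : ℂ)) q * nablaQ j 0 (fun y => (v y : ℂ)) q)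

/-- The sign `δ^{i₁j₁…iₙjₙ}_{01…(2n-1)}` of a (possibly non-bijective) index assignment. -/
def permSignC {m : ℕ} (f : Fin m → Fin m) : ℂ :=
  if h : Function.Bijective f then ((Equiv.Perm.sign (Equiv.ofBijective f h) : ℤ) : ℂ) else 0

/-- Flattening of `(i₁,j₁,…,iₙ,jₙ)` into a self-map of `Fin (2n)`. -/
def flattenQ {n : ℕ} (σ : Fin n → Fin (2 * n) × Fin (2 * n)) : Fin (2 * n) → Fin (2 * n) :=
  fun j => if j.val % 2 = 0 then (σ ⟨j.val / 2, by omega⟩).1 else (σ ⟨j.val / 2, by omega⟩).2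

/-- Density of the mixed quaternionic Monge–Ampère form
`△u₁∧…∧△uₙ = (∑ δ…Δ_{i₁j₁}u₁⋯Δ_{iₙjₙ}uₙ) Ω_{2n}` of smooth functions. -/
def maDensity {n : ℕ} (us : Fin n → (Hn n → ℝ)) (q : Hn n) : ℝ :=
  (∑ σ : Fin n → Fin (2 * n) × Fin (2 * n),
    permSignC (flattenQ σ) * ∏ k : Fin n, bastonQ (σ k).1 (σ k).2 (us k) q).re

/-- Density of `γ(u,v)∧△w₁∧…∧△wₘ` for smooth functions on `ℍ^{m+1}`. -/
def gammaDensity {m : ℕ} (u v : Hn (m + 1) → ℝ) (ws : Fin m → (Hn (m + 1) → ℝ))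
    (q : Hn (m + 1)) : ℝ :=
  (∑ σ : Fin (m + 1) → Fin (2 * (m + 1)) × Fin (2 * (m + 1)),
    permSignC (flattenQ σ) *
      (gammaQ (σ 0).1 (σ 0).2 u v q *
        ∏ k : Fin m, bastonQ (σ k.succ).1 (σ k.succ).2 (ws k) q)).re

/-- The mixed Monge–Ampère measure of smooth functions on `U`. -/
def smoothMA {n : ℕ} (us : Fin n → (Hn n → ℝ)) (U : Set (Hn n)) : Measure (Hn n) :=
  (volume.restrict U).withDensity fun q => ENNReal.ofReal (maDensity us q)

/-! ### Weak convergence and the Bedford–Taylor extension to locally bounded PSH functions -/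

/-- Weak convergence of measures against continuous test functions compactly supported in `Ω`. -/
def TendstoWeaklyOn {n : ℕ} (μs : ℕ → Measure (Hn n)) (μ : Measure (Hn n))
    (Ω : Set (Hn n)) : Prop :=
  ∀ f : Hn n → ℝ, Continuous f → HasCompactSupport f → tsupport f ⊆ Ω →
    Tendsto (fun j => ∫ q, f q ∂(μs j)) atTop (𝓝 (∫ q, f q ∂μ))

/-- `μ` is the mixed Monge–Ampère measure `△u₁∧…∧△uₙ` of the locally bounded
plurisubharmonic functions `us` on `Ω`: on every relatively compact open subset it is the
weak limit of the Monge–Ampère measures of smooth plurisubharmonic functions decreasing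
to the `us`. -/
def IsMixedMA {n : ℕ} (Ω : Set (Hn n)) (us : Fin n → (Hn n → ℝ)) (μ : Measure (Hn n)) : Prop :=
  (∀ U : Set (Hn n), IsOpen U → IsCompact (closure U) → closure U ⊆ Ω →
    ∀ fs : Fin n → ℕ → (Hn n → ℝ),
      (∀ k j, ContDiff ℝ (⊤ : ℕ∞) (fs k j) ∧ QPSHr (fs k j) U) →
      (∀ k, ∀ q ∈ U, Antitone fun j => fs k j q) →
      (∀ k, ∀ q ∈ U, Tendsto (fun j => fs k j q) atTop (𝓝 (us k q))) →
      TendstoWeaklyOn (fun j => smoothMA (fun k => fs k j) U) (μ.restrict U) U) ∧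
  μ Ωᶜ = 0 ∧ ∀ K : Set (Hn n), IsCompact K → K ⊆ Ω → μ K < ⊤

/-- The mixed Monge–Ampère measure of locally bounded plurisubharmonic functions. -/
def MAmix {n : ℕ} (Ω : Set (Hn n)) (us : Fin n → (Hn n → ℝ)) : Measure (Hn n) :=
  open Classical in
  if h : ∃ μ : Measure (Hn n), IsMixedMA Ω us μ then h.choose else 0

/-- The Monge–Ampère measure `(△u)ⁿ` of a locally bounded plurisubharmonic function. -/
def MAn {n : ℕ} (Ω : Set (Hn n)) (u : Hn n → ℝ) : Measure (Hn n) :=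
  MAmix Ω fun _ => u

/-! ### The Cegrell classes -/

/-- Boundary limit zero. -/
def ZeroBdry {n : ℕ} (Ω : Set (Hn n)) (φ : Hn n → ℝ) : Prop :=
  ∀ ζ ∈ frontier Ω, Tendsto φ (𝓝[Ω] ζ) (𝓝 0)

/-- The class `E₀(Ω)` of bounded negative plurisubharmonic functions with zero boundary
values and finite total Monge–Ampère mass. -/
def InE0 {n : ℕ} (Ω : Set (Hn n)) (φ : Hn n → ℝ) : Prop :=
  QPSHr φ Ω ∧ (∀ q ∈ Ω, φ q ≤ 0) ∧ (∃ M : ℝ, ∀ q ∈ Ω, |φ q| ≤ M) ∧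
    ZeroBdry Ω φ ∧ MAn Ω φ Ω < ⊤

/-- `g` is a sequence decreasing pointwise on `Ω` to the `[-∞,∞)`-valued function `u`. -/
def DecTo {n : ℕ} (Ω : Set (Hn n)) (g : ℕ → Hn n → ℝ) (u : Hn n → EReal) : Prop :=
  (∀ q ∈ Ω, Antitone fun j => g j q) ∧
  ∀ q ∈ Ω, Tendsto (fun j => ((g j q : ℝ) : EReal)) atTop (𝓝 (u q))

/-- The class `F(Ω)`. -/
def InF {n : ℕ} (Ω : Set (Hn n)) (u : Hn n → EReal) : Prop :=
  QPSH u Ω ∧ (∀ q ∈ Ω, u q ≤ 0) ∧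
  ∃ g : ℕ → Hn n → ℝ, (∀ j, InE0 Ω (g j)) ∧ DecTo Ω g u ∧ (⨆ j, MAn Ω (g j) Ω) < ⊤

/-- The class `E(Ω)`. -/
def InE {n : ℕ} (Ω : Set (Hn n)) (u : Hn n → EReal) : Prop :=
  QPSH u Ω ∧ (∀ q ∈ Ω, u q ≤ 0) ∧
  ∀ K : Set (Hn n), IsCompact K → K ⊆ Ω →
    ∃ uK : Hn n → EReal, InF Ω uK ∧ ∀ q ∈ K, uK q = u q

/-- The `p`-energy `∫_Ω (−φ)^p (△φ)ⁿ` of `φ ∈ E₀(Ω)`. -/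
def energyP {n : ℕ} (Ω : Set (Hn n)) (p : ℝ) (φ : Hn n → ℝ) : ℝ≥0∞ :=
  ∫⁻ q in Ω, ENNReal.ofReal ((-φ q) ^ p) ∂(MAn Ω φ)

/-- The mutual `p`-energy `∫_Ω (−φ₀)^p △φ₁∧…∧△φₙ`. -/
def mutualEnergyP {n : ℕ} (Ω : Set (Hn n)) (p : ℝ) (φ₀ : Hn n → ℝ)
    (φs : Fin n → (Hn n → ℝ)) : ℝ≥0∞ :=
  ∫⁻ q in Ω, ENNReal.ofReal ((-φ₀ q) ^ p) ∂(MAmix Ω φs)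

/-- The class `E_p(Ω)`. -/
def InEp {n : ℕ} (Ω : Set (Hn n)) (p : ℝ) (u : Hn n → EReal) : Prop :=
  QPSH u Ω ∧ (∀ q ∈ Ω, u q ≤ 0) ∧
  ∃ g : ℕ → Hn n → ℝ, (∀ j, InE0 Ω (g j)) ∧ DecTo Ω g u ∧ (⨆ j, energyP Ω p (g j)) < ⊤

/-! ### The Monge–Ampère operator on the Cegrell classes -/

/-- `μ` is the mixed Monge–Ampère measure `△u¹∧…∧△uⁿ` of functions of the Cegrell
classes: the weak limit on `Ω` of the Monge–Ampère measures of any sequences in `E₀(Ω)`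
decreasing to the `us`. -/
def IsMAmixCl {n : ℕ} (Ω : Set (Hn n)) (us : Fin n → (Hn n → EReal))
    (μ : Measure (Hn n)) : Prop :=
  (∀ gs : Fin n → ℕ → (Hn n → ℝ), (∀ k j, InE0 Ω (gs k j)) →
    (∀ k, DecTo Ω (gs k) (us k)) →
    TendstoWeaklyOn (fun j => MAmix Ω fun k => gs k j) μ Ω) ∧
  μ Ωᶜ = 0 ∧ ∀ K : Set (Hn n), IsCompact K → K ⊆ Ω → μ K < ⊤

/-- The mixed Monge–Ampère measure on the Cegrell classes. -/
def MAmixCl {n : ℕ} (Ω : Set (Hn n)) (us : Fin n → (Hn n → EReal)) : Measure (Hn n) :=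
  open Classical in
  if h : ∃ μ : Measure (Hn n), IsMAmixCl Ω us μ then h.choose else 0

/-- The Monge–Ampère measure `(△u)ⁿ` on the Cegrell classes. -/
def MAnCl {n : ℕ} (Ω : Set (Hn n)) (u : Hn n → EReal) : Measure (Hn n) :=
  MAmixCl Ω fun _ => u

/-- `(△u)ⁿ = μ` for `u` in a Cegrell class. -/
def IsMAnCl {n : ℕ} (Ω : Set (Hn n)) (u : Hn n → EReal) (μ : Measure (Hn n)) : Prop :=
  IsMAmixCl Ω (fun _ => u) μ

/-- The `[0,∞]`-valued part of an extended real number. -/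
def erealToENN (x : EReal) : ℝ≥0∞ :=
  if x = ⊤ then ⊤ else ENNReal.ofReal x.toReal

/-- The quaternionic energy `E(u) = ∫_Ω (−u)(△u)ⁿ` of `u ∈ E₁(Ω)`. -/
def energyCl {n : ℕ} (Ω : Set (Hn n)) (u : Hn n → EReal) : ℝ≥0∞ :=
  ∫⁻ q in Ω, erealToENN (-(u q)) ∂(MAnCl Ω u)

/-- A positive measure has finite quaternionic `1`-energy (`μ ∈ M₁`). -/
def InM1 {n : ℕ} (Ω : Set (Hn n)) (μ : Measure (Hn n)) : Prop :=
  ∃ C : ℝ, 0 < C ∧ ∀ u : Hn n → EReal, InEp Ω 1 u →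
    (∫⁻ q in Ω, erealToENN (-(u q)) ∂μ) ≤
      ENNReal.ofReal C * (energyCl Ω u) ^ ((1 : ℝ) / (n + 1))

/-- The energy functional `F_μ(u) = (1/(n+1)) E(u) + ∫_Ω u dμ`. -/
def energyFunc {n : ℕ} (Ω : Set (Hn n)) (μ : Measure (Hn n)) (u : Hn n → EReal) : ℝ :=
  (1 / (n + 1) : ℝ) * (energyCl Ω u).toReal - (∫⁻ q in Ω, erealToENN (-(u q)) ∂μ).toReal

/-- A positive Radon measure in `Ω`. -/
def RadonOn {n : ℕ} (μ : Measure (Hn n)) (Ω : Set (Hn n)) : Prop :=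
  μ Ωᶜ = 0 ∧ ∀ K : Set (Hn n), IsCompact K → K ⊆ Ω → μ K < ⊤

end

noncomputable section

/-- The relatively extremal function `u_{K,Ω}`. -/
def relExt {n : ℕ} (Ω K : Set (Hn n)) (q : Hn n) : EReal :=
  sSup {y : EReal | ∃ u : Hn n → EReal, QPSH u Ω ∧ (∀ x ∈ Ω, u x ≤ 0) ∧
    (∀ x ∈ K, u x ≤ -1) ∧ y = u q}

/-- The upper semicontinuous regularization of `u` on `Ω`. -/
def uscReg {n : ℕ} (u : Hn n → EReal) (Ω : Set (Hn n)) (x : Hn n) : EReal :=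
  Filter.limsup u (𝓝[Ω] x)

/-- The Euclidean norm on `ℍⁿ ≅ ℝ^{4n}`. -/
def enormQ {n : ℕ} (q : Hn n) : ℝ := Real.sqrt (∑ k, ‖q k‖ ^ 2)

/-- The open Euclidean ball in `ℍⁿ`. -/
def eBall {n : ℕ} (a : Hn n) (r : ℝ) : Set (Hn n) := {q | enormQ (q - a) < r}

/-- The closed Euclidean ball in `ℍⁿ`. -/
def eClosedBall {n : ℕ} (a : Hn n) (r : ℝ) : Set (Hn n) := {q | enormQ (q - a) ≤ r}

/-! ### Second derivatives and the Laplacian on `ℍ` -/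

lemma secondDeriv_of_hasFDerivAt {f : ℍ → ℝ} {f' : ℍ → ℍ →L[ℝ] ℝ} {x v : ℍ} {L : ℍ →L[ℝ] ℝ}
    (hf : ∀ᶠ y in 𝓝 x, HasFDerivAt f (f' y) y) (hL : HasFDerivAt (fun y => f' y v) L x) :
    secondDeriv f x v = L v := by
  have h : (fun y => fderiv ℝ f y v) =ᶠ[𝓝 x] fun y => f' y v := by
    filter_upwards [hf] with y hy
    rw [hy.fderiv]
  rw [secondDeriv, h.fderiv_eq, hL.fderiv]

lemma ContDiffAt.eventually_hasFDerivAt {f : ℍ → ℝ} {x : ℍ} (hf : ContDiffAt ℝ 2 f x) :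
    ∀ᶠ y in 𝓝 x, HasFDerivAt f (fderiv ℝ f y) y := by
  filter_upwards [hf.eventually (by simp)] with y hy
  exact (hy.differentiableAt (by norm_num)).hasFDerivAt

lemma ContDiffAt.differentiableAt_fderiv_apply {f : ℍ → ℝ} {x : ℍ} (hf : ContDiffAt ℝ 2 f x)
    (v : ℍ) : DifferentiableAt ℝ (fun y => fderiv ℝ f y v) x :=
  ((hf.fderiv_right (m := 1) (by norm_num)).differentiableAt (by norm_num)).clm_apply
    (differentiableAt_const v)

lemma secondDeriv_add {f g : ℍ → ℝ} {x : ℍ} (hf : ContDiffAt ℝ 2 f x) (hg : ContDiffAt ℝ 2 g x)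
    (v : ℍ) :
    secondDeriv (fun y => f y + g y) x v = secondDeriv f x v + secondDeriv g x v := by
  rw [secondDeriv_of_hasFDerivAt (f' := fun y => fderiv ℝ f y + fderiv ℝ g y)
    (L := fderiv ℝ (fun y => fderiv ℝ f y v) x + fderiv ℝ (fun y => fderiv ℝ g y v) x)]
  · rfl
  · filter_upwards [hf.eventually_hasFDerivAt, hg.eventually_hasFDerivAt] with y h1 h2
    exact h1.add h2
  · exact (hf.differentiableAt_fderiv_apply v).hasFDerivAt.add
      (hg.differentiableAt_fderiv_apply v).hasFDerivAt

lemma secondDeriv_const_mul {f : ℍ → ℝ} {x : ℍ} (hf : ContDiffAt ℝ 2 f x) (c : ℝ) (v : ℍ) :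
    secondDeriv (fun y => c * f y) x v = c * secondDeriv f x v := by
  rw [secondDeriv_of_hasFDerivAt (f' := fun y => c • fderiv ℝ f y)
    (L := c • fderiv ℝ (fun y => fderiv ℝ f y v) x)]
  · rfl
  · filter_upwards [hf.eventually_hasFDerivAt] with y h1
    exact h1.const_mul c
  · exact (hf.differentiableAt_fderiv_apply v).hasFDerivAt.const_mul c

lemma lapQ_eq_sum (f : ℍ → ℝ) (x : ℍ) : lapQ f x = ∑ k, secondDeriv f x (unitQ k) := by
  rw [Fin.sum_univ_four]
  rfl

lemma Quaternion.inner_eq_add_mul (a b : ℍ) :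
    inner ℝ a b = a.re * b.re + a.imI * b.imI + a.imJ * b.imJ + a.imK * b.imK := by
  simp [Quaternion.inner_def]

lemma inner_unitQ_self (k : Fin 4) : inner ℝ (unitQ k) (unitQ k) = (1 : ℝ) := by
  rw [Quaternion.inner_eq_add_mul]
  fin_cases k <;> simp [unitQ]

lemma sum_inner_unitQ_sq (p : ℍ) : ∑ k, inner ℝ p (unitQ k) ^ 2 = ‖p‖ ^ 2 := by
  rw [sq ‖p‖, ← Quaternion.normSq_eq_norm_mul_self, Quaternion.normSq_def', Fin.sum_univ_four]
  simp only [Quaternion.inner_eq_add_mul]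
  simp [unitQ]

lemma lapQ_add {f g : ℍ → ℝ} {x : ℍ} (hf : ContDiffAt ℝ 2 f x) (hg : ContDiffAt ℝ 2 g x) :
    lapQ (fun y => f y + g y) x = lapQ f x + lapQ g x := by
  simp only [lapQ_eq_sum, secondDeriv_add hf hg, Finset.sum_add_distrib]

lemma lapQ_const_mul {f : ℍ → ℝ} {x : ℍ} (hf : ContDiffAt ℝ 2 f x) (c : ℝ) :
    lapQ (fun y => c * f y) x = c * lapQ f x := by
  simp only [lapQ_eq_sum, secondDeriv_const_mul hf, Finset.mul_sum]

lemma lapQ_const (c : ℝ) (x : ℍ) : lapQ (fun _ => c) x = 0 := by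
  simp [lapQ_eq_sum, secondDeriv]

lemma lapQ_inner_add_const (p : ℍ) (c : ℝ) (x : ℍ) : lapQ (fun y => inner ℝ p y + c) x = 0 := by
  have h : ∀ v, secondDeriv (fun y => inner ℝ p y + c) x v = 0 := fun v => by
    rw [secondDeriv_of_hasFDerivAt (f' := fun _ => innerSL ℝ p) (L := 0)]
    · rfl
    · exact .of_forall fun y => ((innerSL ℝ p).hasFDerivAt (x := y)).add_const c
    · exact hasFDerivAt_const _ _
  simp [lapQ_eq_sum, h]

lemma hasFDerivAt_mul_norm_sub_sq_add (β d : ℝ) (t y : ℍ) :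
    HasFDerivAt (fun y => β * ‖y - t‖ ^ 2 + d) (β • (2 • innerSL ℝ (y - t))) y := by
  have h : HasFDerivAt (fun y : ℍ => ‖y - t‖ ^ 2) (2 • innerSL ℝ (y - t)) y := by
    simpa using ((hasFDerivAt_id y).sub_const t).norm_sq
  exact (h.const_mul β).add_const d

lemma hasFDerivAt_inner_sub (t v y : ℍ) :
    HasFDerivAt (fun y => inner ℝ (y - t) v) (innerSL ℝ v) y := by
  have h : (fun y => inner ℝ (y - t) v) = fun y => innerSL ℝ v y - inner ℝ v t := by
    ext y
    rw [real_inner_comm, inner_sub_right]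
    simp
  rw [h]
  exact (innerSL ℝ v).hasFDerivAt.sub_const _

lemma lapQ_norm_sq (x : ℍ) : lapQ (fun y => ‖y‖ ^ 2) x = 8 := by
  have h : ∀ v, secondDeriv (fun y => ‖y‖ ^ 2) x v = 2 * inner ℝ v v := fun v => by
    rw [secondDeriv_of_hasFDerivAt (f' := fun y => (1 : ℝ) • (2 • innerSL ℝ (y - 0)))
      (L := (2 : ℝ) • innerSL ℝ v)]
    · simp
    · exact .of_forall fun y => by simpa using hasFDerivAt_mul_norm_sub_sq_add 1 0 0 y
    · simpa using (hasFDerivAt_inner_sub 0 v x).const_mul 2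
  simp only [lapQ_eq_sum, h, inner_unitQ_self]
  norm_num

/-- The Laplacian of `(β‖y - t‖² + d)⁻¹`. -/
lemma lapQ_inv {β d : ℝ} {t x : ℍ} (hN : β * ‖x - t‖ ^ 2 + d ≠ 0) :
    lapQ (fun y => (β * ‖y - t‖ ^ 2 + d)⁻¹) x =
      -(8 * β * d) / (β * ‖x - t‖ ^ 2 + d) ^ 3 := by
  set N : ℍ → ℝ := fun y => β * ‖y - t‖ ^ 2 + d with hNdef
  have hN' : ∀ y, HasFDerivAt N (β • (2 • innerSL ℝ (y - t))) y :=
    hasFDerivAt_mul_norm_sub_sq_add β d t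
  have hinv : ∀ y, N y ≠ 0 → HasFDerivAt (fun y => (N y)⁻¹)
      ((-(N y ^ 2)⁻¹) • (β • (2 • innerSL ℝ (y - t)))) y := fun y hy =>
    (hasDerivAt_inv hy).comp_hasFDerivAt y (hN' y)
  have hsq : HasFDerivAt (fun y => -(N y ^ 2)⁻¹)
      ((2 * (N x ^ 3)⁻¹) • (β • (2 • innerSL ℝ (x - t)))) x := by
    have h1 : HasDerivAt (fun s : ℝ => -(s ^ 2)⁻¹) (2 * (N x ^ 3)⁻¹) (N x) := by
      have := ((hasDerivAt_pow 2 (N x)).fun_inv (pow_ne_zero 2 hN)).fun_neg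
      refine this.congr_deriv ?_
      have : N x ≠ 0 := hN
      field_simp
      push_cast
      ring
    exact h1.comp_hasFDerivAt x (hN' x)
  have hcont : ContinuousAt N x := (hN' x).continuousAt
  have h : ∀ v, secondDeriv (fun y => (N y)⁻¹) x v =
      -(N x ^ 2)⁻¹ * (2 * β * inner ℝ v v) +
        2 * (N x ^ 3)⁻¹ * (2 * β) ^ 2 * inner ℝ (x - t) v ^ 2 := fun v => by
    have h2 := hsq.mul ((hasFDerivAt_inner_sub t v x).const_mul (2 * β))
    rw [secondDeriv_of_hasFDerivAt
      (f' := fun y => (-(N y ^ 2)⁻¹) • (β • (2 • innerSL ℝ (y - t))))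
      ((hcont.eventually_ne hN).mono fun y hy => hinv y hy)
      (h2.congr_of_eventuallyEq (.of_forall fun y => ?_))]
    · simp [-map_sub, inner_sub_left]
      ring
    · simp [-map_sub, inner_sub_left]
      ring_nf
      simp
  have hd : d = N x - β * ‖x - t‖ ^ 2 := by simp [hNdef]
  have hNx : N x ≠ 0 := hN
  change lapQ (fun y => (N y)⁻¹) x = -(8 * β * d) / N x ^ 3
  rw [hd]
  simp only [lapQ_eq_sum, h, inner_unitQ_self, Finset.sum_add_distrib, ← Finset.mul_sum,
    sum_inner_unitQ_sq]
  simp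
  field_simp
  ring

lemma contDiff_mul_norm_sub_sq_add (β d : ℝ) (t : ℍ) :
    ContDiff ℝ 2 fun y : ℍ => β * ‖y - t‖ ^ 2 + d :=
  (contDiff_const.mul ((contDiff_id.sub contDiff_const).norm_sq ℝ)).add contDiff_const

lemma IsLocalMax.secondDeriv_nonpos {f : ℍ → ℝ} {x : ℍ} (hf : ContDiffAt ℝ 2 f x)
    (hmax : IsLocalMax f x) (v : ℍ) : secondDeriv f x v ≤ 0 := by
  by_contra! hpos
  have hline : ∀ s : ℝ, HasDerivAt (fun s : ℝ => x + s • v) v s := fun s => by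
    simpa using ((hasDerivAt_id s).smul_const v).const_add x
  have hcont : Tendsto (fun s : ℝ => x + s • v) (𝓝 0) (𝓝 x) := by
    simpa using (hline 0).continuousAt.tendsto
  set φ : ℝ → ℝ := fun s => f (x + s • v)
  have h1 : deriv φ =ᶠ[𝓝 0] fun s => fderiv ℝ f (x + s • v) v := by
    filter_upwards [hcont.eventually hf.eventually_hasFDerivAt] with s hs
    exact (hs.comp_hasDerivAt s (hline s)).deriv
  have h2 : HasDerivAt (fun s : ℝ => fderiv ℝ f (x + s • v) v) (secondDeriv f x v) 0 := by
    have h := (hf.differentiableAt_fderiv_apply v).hasFDerivAt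
    rw [show x = x + (0 : ℝ) • v by simp] at h
    have h' := h.comp_hasDerivAt (0 : ℝ) (hline 0)
    rwa [zero_smul, add_zero] at h'
  have hφmax : IsLocalMax φ 0 := by
    have := hcont.eventually hmax
    simpa [IsLocalMax, IsMaxFilter, φ] using this
  have h3 : deriv (deriv φ) 0 = secondDeriv f x v := by rw [h1.deriv_eq, h2.deriv]
  have hφc : ContinuousAt φ 0 := by
    have : ContinuousAt f (x + (0 : ℝ) • v) := by simpa using hf.continuousAt
    exact ContinuousAt.comp (g := f) this (hline 0).continuousAt
  have hmin : IsLocalMin φ 0 :=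
    isLocalMin_of_deriv_deriv_pos (h3 ▸ hpos) hφmax.deriv_eq_zero hφc
  have hconst : φ =ᶠ[𝓝 0] fun _ => φ 0 := by
    filter_upwards [hφmax, hmin] with s h h'
    exact le_antisymm h h'
  have h4 : deriv φ =ᶠ[𝓝 0] fun _ => 0 := by
    simpa using hconst.deriv
  rw [← h3, h4.deriv_eq] at hpos
  simp at hpos

lemma IsLocalMax.lapQ_nonpos {f : ℍ → ℝ} {x : ℍ} (hf : ContDiffAt ℝ 2 f x)
    (hmax : IsLocalMax f x) : lapQ f x ≤ 0 := by
  have h := hmax.secondDeriv_nonpos hf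
  rw [lapQ_eq_sum]
  exact Finset.sum_nonpos fun k _ => h _

/-! ### The maximum principle -/

/-- The value of `w` at `x` is dominated by the value of every harmonic function on the ball of
radius `r` centred at `x` which lies above `w` on the sphere. -/
def HarmonicBoundAt (w : ℍ → EReal) (x : ℍ) (r : ℝ) : Prop :=
  ∀ h : ℍ → ℝ, ContinuousOn h (Metric.closedBall x r) → HarmonicOnQ h (Metric.ball x r) →
    (∀ y ∈ Metric.sphere x r, w y ≤ (h y : EReal)) → w x ≤ (h x : EReal)

lemma HarmonicOnQ.mono {h : ℍ → ℝ} {s t : Set ℍ} (hh : HarmonicOnQ h t) (hst : s ⊆ t) :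
    HarmonicOnQ h s :=
  ⟨hh.1.mono hst, fun x hx => hh.2 x (hst hx)⟩

lemma HarmonicOnQ.contDiffAt {h : ℍ → ℝ} {s : Set ℍ} (hs : IsOpen s) (hh : HarmonicOnQ h s)
    {x : ℍ} (hx : x ∈ s) : ContDiffAt ℝ 2 h x :=
  hh.1.contDiffAt (hs.mem_nhds hx)

lemma HarmonicOnQ.add_inner_add_const {h : ℍ → ℝ} {s : Set ℍ} (hs : IsOpen s)
    (hh : HarmonicOnQ h s) (p : ℍ) (c : ℝ) :
    HarmonicOnQ (fun y => h y + (inner ℝ p y + c)) s := by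
  have hc : ContDiff ℝ 2 fun y : ℍ => inner ℝ p y + c :=
    (contDiff_const.inner ℝ contDiff_id).add contDiff_const
  refine ⟨hh.1.add hc.contDiffOn, fun x hx => ?_⟩
  rw [lapQ_add (hh.contDiffAt hs hx) hc.contDiffAt, hh.2 x hx, lapQ_inner_add_const, add_zero]

lemma HarmonicOnQ.add_const {h : ℍ → ℝ} {s : Set ℍ} (hs : IsOpen s)
    (hh : HarmonicOnQ h s) (c : ℝ) : HarmonicOnQ (fun y => h y + c) s := by
  simpa using hh.add_inner_add_const hs 0 c

lemma HarmonicOnQ.const_mul {h : ℍ → ℝ} {s : Set ℍ} (hs : IsOpen s)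
    (hh : HarmonicOnQ h s) (c : ℝ) : HarmonicOnQ (fun y => c * h y) s :=
  ⟨contDiffOn_const.mul hh.1, fun x hx => by
    rw [lapQ_const_mul (hh.contDiffAt hs hx), hh.2 x hx, mul_zero]⟩

/-- The maximum principle for functions which satisfy a local comparison with harmonic
functions. -/
lemma le_of_harmonicBoundAt {w : ℍ → EReal} {h : ℍ → ℝ} {C U : Set ℍ} (hC : IsCompact C)
    (hU : IsOpen U) (hUC : U ⊆ C) (hw : UpperSemicontinuousOn w C) (hwtop : ∀ t ∈ C, w t ≠ ⊤)
    (hh : ContinuousOn h C) (hharm : HarmonicOnQ h U)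
    (hloc : ∀ t ∈ U, ∃ᶠ r in 𝓝[>] 0, HarmonicBoundAt w t r)
    (hbd : ∀ t ∈ C \ U, w t ≤ (h t : EReal)) : ∀ t ∈ C, w t ≤ (h t : EReal) := by
  by_contra! hcon
  obtain ⟨t₁, ht₁, hlt⟩ := hcon
  obtain ⟨x₁, hx₁⟩ : ∃ x₁ : ℝ, w t₁ = x₁ :=
    ⟨_, (EReal.coe_toReal (hwtop _ ht₁) (ne_bot_of_gt hlt)).symm⟩
  rw [hx₁, EReal.coe_lt_coe_iff] at hlt
  obtain ⟨B, hB⟩ := hC.isBounded.exists_norm_le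
  have hB0 : 0 ≤ B := (norm_nonneg _).trans (hB t₁ ht₁)
  set δ : ℝ := (x₁ - h t₁) / (B ^ 2 + 1) with hδ
  have hδ0 : 0 < δ := div_pos (sub_pos.2 hlt) (by positivity)
  have hδB : δ * B ^ 2 < x₁ - h t₁ := by
    have : δ * (B ^ 2 + 1) = x₁ - h t₁ := div_mul_cancel₀ _ (by positivity)
    linarith
  set k : ℍ → ℝ := fun t => -h t + δ * ‖t‖ ^ 2 - δ * B ^ 2 with hk
  have hkc : ContinuousOn k C :=
    (hh.neg.add (continuousOn_const.mul (continuous_norm.pow 2).continuousOn)).sub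
      continuousOn_const
  have hF : UpperSemicontinuousOn (fun t => w t + (k t : EReal)) C :=
    hw.add' (continuous_coe_real_ereal.comp_continuousOn hkc).upperSemicontinuousOn
      fun t ht => EReal.continuousAt_add (.inr (EReal.coe_ne_bot _)) (.inr (EReal.coe_ne_top _))
  obtain ⟨t₀, ht₀, hmax⟩ := hF.exists_isMaxOn ⟨t₁, ht₁⟩ hC
  have hmax₁ : w t₁ + (k t₁ : EReal) ≤ w t₀ + (k t₀ : EReal) := hmax ht₁
  obtain ⟨x₀, hx₀⟩ : ∃ x₀ : ℝ, w t₀ = x₀ := by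
    refine ⟨_, (EReal.coe_toReal (hwtop _ ht₀) fun hbot => ?_).symm⟩
    rw [hbot, hx₁, EReal.bot_add, ← EReal.coe_add] at hmax₁
    exact EReal.coe_ne_bot _ (le_bot_iff.1 hmax₁)
  have hpos : 0 < x₀ + k t₀ := by
    rw [hx₀, hx₁, ← EReal.coe_add, ← EReal.coe_add, EReal.coe_le_coe_iff] at hmax₁
    refine lt_of_lt_of_le ?_ hmax₁
    have : 0 ≤ δ * ‖t₁‖ ^ 2 := by positivity
    simp only [hk]
    linarith
  have hle : ∀ t ∈ C, w t ≤ ((x₀ + k t₀ - k t : ℝ) : EReal) := fun t ht => by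
    have h1 : w t + (k t : EReal) ≤ w t₀ + (k t₀ : EReal) := hmax ht
    rw [EReal.coe_sub, EReal.coe_add, ← hx₀]
    exact EReal.le_sub_iff_add_le (.inl (EReal.coe_ne_bot _)) (.inl (EReal.coe_ne_top _)) |>.2 h1
  have ht₀U : t₀ ∈ U := by
    by_contra hn
    have h1 := hbd t₀ ⟨ht₀, hn⟩
    rw [hx₀, EReal.coe_le_coe_iff] at h1
    have h2 : δ * ‖t₀‖ ^ 2 ≤ δ * B ^ 2 := by gcongr; exact hB t₀ ht₀
    simp only [hk] at hpos
    linarith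
  obtain ⟨s, hs, hs0, hsU⟩ : ∃ s, HarmonicBoundAt w t₀ s ∧ 0 < s ∧
      Metric.closedBall t₀ s ⊆ U := by
    have h1 : ∀ᶠ s in 𝓝[>] (0 : ℝ), 0 < s ∧ Metric.closedBall t₀ s ⊆ U :=
      (eventually_mem_nhdsWithin).and (nhdsWithin_le_nhds
        (eventually_closedBall_subset (hU.mem_nhds ht₀U)))
    exact ((hloc t₀ ht₀U).and_eventually h1).exists
  have hnorm : ∀ t, ‖t‖ ^ 2 = ‖t - t₀‖ ^ 2 + 2 * inner ℝ t₀ t - ‖t₀‖ ^ 2 := fun t => by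
    rw [norm_sub_sq_real, real_inner_comm]
    ring
  have hfin := hs (fun t => h t + (inner ℝ (-(2 * δ) • t₀) t +
      (x₀ + k t₀ + δ * B ^ 2 - δ * (s ^ 2 - ‖t₀‖ ^ 2))))
    ((hh.mono (hsU.trans hUC)).add (by fun_prop))
    ((hharm.mono (Metric.ball_subset_closedBall.trans hsU)).add_inner_add_const
      Metric.isOpen_ball _ _) fun y hy => by
        refine (hle y (hUC (hsU (Metric.sphere_subset_closedBall hy)))).trans ?_
        rw [EReal.coe_le_coe_iff]
        have h3 : ‖y - t₀‖ = s := by simpa [dist_eq_norm] using hy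
        have h4 := hnorm y
        rw [h3] at h4
        simp only [hk, inner_smul_left, h4]
        simp
        linarith
  rw [hx₀, EReal.coe_le_coe_iff] at hfin
  simp only [hk, inner_smul_left, real_inner_self_eq_norm_sq] at hfin
  simp at hfin
  nlinarith [mul_pos hδ0 (pow_pos hs0 2)]

lemma SubharmonicOn.harmonicBoundAt {w : ℍ → EReal} {s : Set ℍ} (hw : SubharmonicOn w s)
    {x : ℍ} {r : ℝ} (hr : 0 < r) (hs : Metric.closedBall x r ⊆ s) : HarmonicBoundAt w x r :=
  fun h hc hh hle => hw.2.2 x r hr hs h hc hh hle x (Metric.mem_closedBall_self hr.le)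

/-- Subharmonicity is a local property. -/
lemma subharmonicOn_of_harmonicBoundAt {w : ℍ → EReal} {s : Set ℍ}
    (hw : UpperSemicontinuousOn w s) (htop : ∀ x ∈ s, w x ≠ ⊤)
    (hloc : ∀ t ∈ s, s ∈ 𝓝 t → ∃ᶠ r in 𝓝[>] 0, HarmonicBoundAt w t r) :
    SubharmonicOn w s := by
  refine ⟨hw, htop, fun x r hr hs h hc hh hle => ?_⟩
  refine le_of_harmonicBoundAt (isCompact_closedBall x r) Metric.isOpen_ball
    Metric.ball_subset_closedBall (hw.mono hs) (fun t ht => htop t (hs ht)) hc hh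
    (fun t ht => hloc t (hs (Metric.ball_subset_closedBall ht)) ?_) fun t ht => ?_
  · exact mem_of_superset (Metric.isOpen_ball.mem_nhds ht) (Metric.ball_subset_closedBall.trans hs)
  · refine hle t ?_
    rw [← Metric.closedBall_sdiff_ball]
    exact ht

/-- A `C²` function with nonnegative Laplacian satisfies the comparison with harmonic
functions. -/
lemma harmonicBoundAt_of_lapQ_nonneg {f : ℍ → ℝ} {x : ℍ} {r : ℝ} (hr : 0 < r)
    (hf : ∀ y ∈ Metric.closedBall x r, ContDiffAt ℝ 2 f y)
    (hlap : ∀ y ∈ Metric.closedBall x r, 0 ≤ lapQ f y) :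
    HarmonicBoundAt (fun y => (f y : EReal)) x r := by
  intro h hc hh hle
  rw [EReal.coe_le_coe_iff]
  obtain ⟨B, hB⟩ := (isCompact_closedBall x r).isBounded.exists_norm_le
  have hx := Metric.mem_closedBall_self (x := x) hr.le
  have hB0 : 0 ≤ B := (norm_nonneg _).trans (hB x hx)
  by_contra! hlt
  set δ : ℝ := (f x - h x) / (B ^ 2 + 1) with hδ
  have hδ0 : 0 < δ := div_pos (sub_pos.2 hlt) (by positivity)
  have hδB : δ * B ^ 2 < f x - h x := by
    have : δ * (B ^ 2 + 1) = f x - h x := div_mul_cancel₀ _ (by positivity)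
    linarith
  have hfc : ContinuousOn f (Metric.closedBall x r) := fun y hy =>
    (hf y hy).continuousAt.continuousWithinAt
  have hcont : ContinuousOn (fun y => (f y + (-1) * h y) + δ * ‖y‖ ^ 2)
      (Metric.closedBall x r) :=
    (hfc.add (continuousOn_const.mul hc)).add
      (continuousOn_const.mul (continuous_norm.pow 2).continuousOn)
  obtain ⟨t, ht, hmax⟩ := (isCompact_closedBall x r).exists_isMaxOn ⟨x, hx⟩ hcont
  have hxt := hmax hx
  simp only [Set.mem_ofPred_eq] at hxt
  by_cases hts : t ∈ Metric.ball x r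
  · have hloc : IsLocalMax (fun y => (f y + (-1) * h y) + δ * ‖y‖ ^ 2) t :=
      hmax.isLocalMax (mem_of_superset (Metric.isOpen_ball.mem_nhds hts)
        Metric.ball_subset_closedBall)
    have hh2 := hh.contDiffAt Metric.isOpen_ball hts
    have h1 : ContDiffAt ℝ 2 (fun y => (-1) * h y) t := contDiffAt_const.mul hh2
    have h2 : ContDiffAt ℝ 2 (fun y : ℍ => ‖y‖ ^ 2) t := (contDiff_id.norm_sq ℝ).contDiffAt
    have h3 := hloc.lapQ_nonpos (((hf t ht).add h1).add (contDiffAt_const.mul h2))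
    rw [lapQ_add ((hf t ht).add h1) (contDiffAt_const.mul h2), lapQ_add (hf t ht) h1,
      lapQ_const_mul hh2, lapQ_const_mul h2, hh.2 t hts, lapQ_norm_sq] at h3
    linarith [hlap t ht]
  · have h1 := hle t (by rw [← Metric.closedBall_sdiff_ball]; exact ⟨ht, hts⟩)
    rw [EReal.coe_le_coe_iff] at h1
    have h2 : δ * ‖t‖ ^ 2 ≤ δ * B ^ 2 := by gcongr; exact hB t ht
    have h3 : 0 ≤ δ * ‖x‖ ^ 2 := by positivity
    linarith

lemma harmonicBoundAt_const (c : ℝ) {x : ℍ} {r : ℝ} (hr : 0 < r) :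
    HarmonicBoundAt (fun _ => (c : EReal)) x r :=
  harmonicBoundAt_of_lapQ_nonneg (f := fun _ => c) hr (fun _ _ => contDiffAt_const)
    fun y _ => (lapQ_const c y).ge

/-! ### Euclidean balls and quaternionic lines -/

section Balls

variable {n : ℕ}

lemma enormQ_nonneg (q : Hn n) : 0 ≤ enormQ q := Real.sqrt_nonneg _

lemma enormQ_sq (q : Hn n) : enormQ q ^ 2 = ∑ k, ‖q k‖ ^ 2 :=
  Real.sq_sqrt (Finset.sum_nonneg fun _ _ => sq_nonneg _)

lemma continuous_enormQ : Continuous (enormQ : Hn n → ℝ) := by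
  unfold enormQ
  fun_prop

lemma enormQ_smul (c : ℝ) (q : Hn n) : enormQ (c • q) = |c| * enormQ q := by
  rw [← sq_eq_sq₀ (enormQ_nonneg _) (mul_nonneg (abs_nonneg _) (enormQ_nonneg _)), mul_pow,
    enormQ_sq, enormQ_sq, Finset.mul_sum]
  refine Finset.sum_congr rfl fun k _ => ?_
  rw [Pi.smul_apply, norm_smul, mul_pow, Real.norm_eq_abs]

lemma norm_le_enormQ (q : Hn n) : ‖q‖ ≤ enormQ q := by
  refine (pi_norm_le_iff_of_nonneg (enormQ_nonneg q)).2 fun k => ?_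
  refine (sq_le_sq₀ (norm_nonneg _) (enormQ_nonneg q)).1 ?_
  rw [enormQ_sq]
  exact Finset.single_le_sum (f := fun k => ‖q k‖ ^ 2) (fun _ _ => sq_nonneg _) (Finset.mem_univ k)

lemma enormQ_zero : enormQ (0 : Hn n) = 0 := by simp [enormQ]

lemma continuous_qLine (a b : Hn n) : Continuous (qLine a b) :=
  continuous_pi fun _ => continuous_const.add (continuous_const.mul continuous_id)

lemma norm_add_mul_sq (p b t : ℍ) :
    ‖p + b * t‖ ^ 2 = ‖p‖ ^ 2 + 2 * inner ℝ (star b * p) t + ‖b‖ ^ 2 * ‖t‖ ^ 2 := by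
  have h : inner ℝ p (b * t) = inner ℝ (star b * p) t := by
    simp only [Quaternion.inner_eq_add_mul]
    simp
    ring
  rw [norm_add_sq_real, h, norm_mul, mul_pow]

/-- On a quaternionic line the squared distance to a point is a radial quadratic function. -/
lemma exists_enormQ_qLine_sub_sq (a b c : Hn n) : ∃ (t₁ : ℍ) (d : ℝ), 0 ≤ d ∧
    ∀ t, enormQ (qLine c b t - a) ^ 2 = enormQ b ^ 2 * ‖t - t₁‖ ^ 2 + d := by
  set m : ℍ := ∑ k, star (b k) * (c k - a k) with hm
  have h : ∀ t, enormQ (qLine c b t - a) ^ 2 =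
      enormQ (c - a) ^ 2 + 2 * inner ℝ m t + enormQ b ^ 2 * ‖t‖ ^ 2 := fun t => by
    simp only [enormQ_sq, hm, sum_inner, Finset.sum_mul, Finset.mul_sum,
      ← Finset.sum_add_distrib]
    refine Finset.sum_congr rfl fun k _ => ?_
    simp only [Pi.sub_apply]
    rw [← norm_add_mul_sq, qLine]
    congr 2
    abel
  rcases (sq_nonneg (enormQ b)).eq_or_lt with hb | hb
  · have hb' : ∀ k, b k = 0 := fun k => by
      have : b = 0 := norm_le_zero_iff.1 ((norm_le_enormQ b).trans_eq (by simpa using hb.symm))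
      simp [this]
    refine ⟨0, enormQ (c - a) ^ 2, sq_nonneg _, fun t => ?_⟩
    rw [h t, ← hb]
    simp [hm, hb']
  · set β := enormQ b ^ 2
    have hkey : ∀ t, enormQ (qLine c b t - a) ^ 2 = β * ‖t - (-(β⁻¹ • m))‖ ^ 2 +
        (enormQ (c - a) ^ 2 - β⁻¹ * ‖m‖ ^ 2) := fun t => by
      rw [h t, sub_neg_eq_add, norm_add_sq_real, inner_smul_right, norm_smul, mul_pow,
        real_inner_comm, Real.norm_eq_abs, sq_abs]
      field_simp
      ring
    refine ⟨-(β⁻¹ • m), _, ?_, hkey⟩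
    have := hkey (-(β⁻¹ • m))
    rw [sub_self, norm_zero] at this
    linarith [sq_nonneg (enormQ (qLine c b (-(β⁻¹ • m)) - a))]

lemma QPSH.mono {u : Hn n → EReal} {Ω Ω' : Set (Hn n)} (hu : QPSH u Ω) (h : Ω' ⊆ Ω) :
    QPSH u Ω' := by
  refine ⟨hu.1.mono h, fun q hq => hu.2.1 q (h hq), fun a b => ?_⟩
  obtain ⟨h1, h2, h3⟩ := hu.2.2 a b
  exact ⟨h1.mono fun t ht => h ht, fun t ht => h2 t (h ht),
    fun x r hr hs => h3 x r hr fun t ht => h (hs ht)⟩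

lemma qpsh_const (c : ℝ) (Ω : Set (Hn n)) : QPSH (fun _ => (c : EReal)) Ω :=
  ⟨upperSemicontinuousOn_const, fun _ _ => EReal.coe_ne_top _, fun _ _ =>
    subharmonicOn_of_harmonicBoundAt upperSemicontinuousOn_const (fun _ _ => EReal.coe_ne_top _)
      fun _ _ _ => Eventually.frequently <|
        eventually_mem_nhdsWithin.mono fun _ hr => harmonicBoundAt_const c hr⟩

/-- The relatively extremal function of the closed ball of radius `r` in the ball of radius `R`
centred at `a`. -/
def ballExt (a : Hn n) (r R : ℝ) (q : Hn n) : ℝ :=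
  ((R ^ 2)⁻¹ - (max (enormQ (q - a) ^ 2) (r ^ 2))⁻¹) / ((r ^ 2)⁻¹ - (R ^ 2)⁻¹)

lemma inv_sq_sub_inv_sq_pos {r R : ℝ} (hr : 0 < r) (hrR : r < R) :
    0 < (r ^ 2)⁻¹ - (R ^ 2)⁻¹ :=
  sub_pos.2 (inv_strictAnti₀ (by positivity) (by gcongr))

lemma continuous_ballExt (a : Hn n) {r : ℝ} (hr : 0 < r) (R : ℝ) :
    Continuous (ballExt a r R) := by
  refine (continuous_const.sub (Continuous.inv₀ ?_ fun q => ?_)).div_const _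
  · exact ((continuous_enormQ.comp (continuous_id.sub continuous_const)).pow 2).max
      continuous_const
  · exact (lt_max_of_lt_right (by positivity)).ne'

lemma ballExt_of_le {a : Hn n} {r R : ℝ} (hr : 0 < r) (hrR : r < R) {q : Hn n}
    (hq : enormQ (q - a) ^ 2 ≤ r ^ 2) : ballExt a r R q = -1 := by
  have h := inv_sq_sub_inv_sq_pos hr hrR
  rw [ballExt, max_eq_right hq, div_eq_iff h.ne']
  ring

lemma neg_one_le_ballExt (a : Hn n) {r R : ℝ} (hr : 0 < r) (hrR : r < R) (q : Hn n) :
    -1 ≤ ballExt a r R q := by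
  have h := inv_sq_sub_inv_sq_pos hr hrR
  rw [ballExt, le_div_iff₀ h]
  have : (max (enormQ (q - a) ^ 2) (r ^ 2))⁻¹ ≤ (r ^ 2)⁻¹ :=
    inv_anti₀ (by positivity) (le_max_right _ _)
  linarith

lemma ballExt_nonpos {a : Hn n} {r R : ℝ} (hr : 0 < r) (hrR : r < R) {q : Hn n}
    (hq : q ∈ eBall a R) : ballExt a r R q ≤ 0 := by
  refine div_nonpos_of_nonpos_of_nonneg (sub_nonpos.2 (inv_anti₀ ?_ (max_le ?_ ?_)))
    (inv_sq_sub_inv_sq_pos hr hrR).le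
  · exact lt_max_of_lt_right (by positivity)
  · have : enormQ (q - a) < R := hq
    have := enormQ_nonneg (q - a)
    gcongr
  · gcongr

lemma ballExt_eq {a : Hn n} {r R : ℝ} (hr : 0 < r) (hrR : r < R) {q : Hn n} (hqa : q ≠ a) :
    ballExt a r R q = max (-1) ((R ^ (-2 : ℤ) - enormQ (q - a) ^ (-2 : ℤ)) /
      (r ^ (-2 : ℤ) - R ^ (-2 : ℤ))) := by
  have hz : ∀ x : ℝ, x ^ (-2 : ℤ) = (x ^ 2)⁻¹ := fun x => by
    rw [zpow_neg]
    norm_cast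
  have h := inv_sq_sub_inv_sq_pos hr hrR
  have hpos : 0 < enormQ (q - a) :=
    (norm_pos_iff.2 (sub_ne_zero.2 hqa)).trans_le (norm_le_enormQ _)
  simp only [hz]
  rcases le_total (enormQ (q - a) ^ 2) (r ^ 2) with hle | hle
  · rw [ballExt_of_le hr hrR hle, max_eq_left]
    rw [div_le_iff₀ h]
    have : (r ^ 2)⁻¹ ≤ (enormQ (q - a) ^ 2)⁻¹ := inv_anti₀ (by positivity) hle
    linarith
  · rw [max_eq_right]
    · rw [ballExt, max_eq_left hle]
    · have := neg_one_le_ballExt a hr hrR q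
      rwa [ballExt, max_eq_left hle] at this

lemma contDiffAt_inv_norm_sub_sq {β d : ℝ} {t₁ t : ℍ} (hN : β * ‖t - t₁‖ ^ 2 + d ≠ 0) :
    ContDiffAt ℝ 2 (fun y => (β * ‖y - t₁‖ ^ 2 + d)⁻¹) t :=
  (contDiff_mul_norm_sub_sq_add β d t₁).contDiffAt.inv hN

lemma lapQ_const_sub_mul_inv (A B : ℝ) {β d : ℝ} {t₁ t : ℍ} (hN : β * ‖t - t₁‖ ^ 2 + d ≠ 0) :
    lapQ (fun y => A + (-B) * (β * ‖y - t₁‖ ^ 2 + d)⁻¹) t =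
      B * (8 * β * d / (β * ‖t - t₁‖ ^ 2 + d) ^ 3) := by
  have h := contDiffAt_inv_norm_sub_sq hN
  rw [lapQ_add contDiffAt_const (contDiffAt_const.mul h), lapQ_const_mul h, lapQ_const,
    lapQ_inv hN]
  ring

lemma qpsh_ballExt (a : Hn n) {r R : ℝ} (hr : 0 < r) (hrR : r < R) (Ω : Set (Hn n)) :
    QPSH (fun q => (ballExt a r R q : EReal)) Ω := by
  have hc : Continuous fun q => (ballExt a r R q : EReal) :=
    continuous_coe_real_ereal.comp (continuous_ballExt a hr R)
  refine ⟨hc.continuousOn.upperSemicontinuousOn, fun _ _ => EReal.coe_ne_top _, fun c b => ?_⟩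
  refine subharmonicOn_of_harmonicBoundAt
    (hc.comp (continuous_qLine c b)).continuousOn.upperSemicontinuousOn
    (fun _ _ => EReal.coe_ne_top _) fun t _ _ => Eventually.frequently ?_
  obtain ⟨t₁, d, hd, hN⟩ := exists_enormQ_qLine_sub_sq a b c
  have hB := inv_sq_sub_inv_sq_pos hr hrR
  rcases le_or_gt (enormQ (qLine c b t - a) ^ 2) (r ^ 2) with hle | hlt
  · filter_upwards [eventually_mem_nhdsWithin] with s hs h hhc hh hbd
    simp only [ballExt_of_le hr hrR hle]
    exact harmonicBoundAt_const (-1) hs h hhc hh fun y hy =>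
      (EReal.coe_le_coe_iff.2 (neg_one_le_ballExt a hr hrR _)).trans (hbd y hy)
  · set V : Set ℍ := {y | r ^ 2 < enormQ (qLine c b y - a) ^ 2}
    have hV : IsOpen V := isOpen_lt continuous_const
      ((continuous_enormQ.comp ((continuous_qLine c b).sub continuous_const)).pow 2)
    have hVpos : ∀ y ∈ V, 0 < enormQ b ^ 2 * ‖y - t₁‖ ^ 2 + d := fun y hy => by
      rw [← hN]
      exact (by positivity : 0 < r ^ 2).trans hy
    have hVeq : ∀ y ∈ V, ballExt a r R (qLine c b y) =
        (R ^ 2)⁻¹ / ((r ^ 2)⁻¹ - (R ^ 2)⁻¹) + (-((r ^ 2)⁻¹ - (R ^ 2)⁻¹)⁻¹) *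
          (enormQ b ^ 2 * ‖y - t₁‖ ^ 2 + d)⁻¹ := fun y hy => by
      rw [ballExt, max_eq_left (le_of_lt hy), hN]
      ring
    filter_upwards [eventually_mem_nhdsWithin,
      nhdsWithin_le_nhds (eventually_closedBall_subset (hV.mem_nhds hlt))] with s hs hsV
    intro h hhc hh hbd
    simp only [hVeq t hlt]
    refine harmonicBoundAt_of_lapQ_nonneg
      (f := fun y => (R ^ 2)⁻¹ / ((r ^ 2)⁻¹ - (R ^ 2)⁻¹) + (-((r ^ 2)⁻¹ - (R ^ 2)⁻¹)⁻¹) *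
        (enormQ b ^ 2 * ‖y - t₁‖ ^ 2 + d)⁻¹) hs (fun y hy => ?_) (fun y hy => ?_) h hhc hh
      fun y hy => ?_
    · exact contDiffAt_const.add (contDiffAt_const.mul
        (contDiffAt_inv_norm_sub_sq (hVpos y (hsV hy)).ne'))
    · have := hVpos y (hsV hy)
      rw [lapQ_const_sub_mul_inv _ _ this.ne']
      positivity
    · simp only [← hVeq y (hsV (Metric.sphere_subset_closedBall hy))]
      exact hbd y hy

lemma EReal.le_coe_of_forall_pos_le_add {x : EReal} {y : ℝ}
    (h : ∀ ε : ℝ, 0 < ε → x ≤ ((y + ε : ℝ) : EReal)) : x ≤ (y : EReal) := by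
  by_contra! hlt
  obtain ⟨z, hyz, hzx⟩ := EReal.lt_iff_exists_real_btwn.1 hlt
  have hz : y < z := EReal.coe_lt_coe_iff.1 hyz
  have := h (z - y) (_root_.sub_pos.2 hz)
  rw [add_sub_cancel] at this
  exact (hzx.trans_le this).false

/-- The barrier estimate on concentric balls. -/
lemma QPSH.le_ballExt {v : Hn n → EReal} {Ω : Set (Hn n)} (hv : QPSH v Ω) {a : Hn n} {r R : ℝ}
    (hr : 0 < r) (hrR : r < R) (hΩ : eBall a R ⊆ Ω) (hv0 : ∀ q ∈ Ω, v q ≤ 0)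
    (hv1 : ∀ q ∈ eClosedBall a r, v q ≤ -1) {q : Hn n} (hq : q ∈ eBall a R) :
    v q ≤ (ballExt a r R q : EReal) := by
  rcases le_or_gt (enormQ (q - a) ^ 2) (r ^ 2) with hle | hlt
  · rw [ballExt_of_le hr hrR hle]
    exact hv1 q ((sq_le_sq₀ (enormQ_nonneg _) hr.le).1 hle)
  refine EReal.le_coe_of_forall_pos_le_add fun ε hε => ?_
  have hR : 0 < R := hr.trans hrR
  set S := enormQ (q - a) ^ 2 with hS
  have hSR : S < R ^ 2 := by
    have h1 : enormQ (q - a) < R := hq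
    have := enormQ_nonneg (q - a)
    rw [hS]
    gcongr
  have hS0 : 0 < S := (by positivity : 0 < r ^ 2).trans hlt
  set D := (r ^ 2)⁻¹ - (R ^ 2)⁻¹ with hD
  have hD0 : 0 < D := inv_sq_sub_inv_sq_pos hr hrR
  obtain ⟨ρ, ⟨hSρ, hρR⟩, hρε⟩ :
      ∃ ρ, ρ ∈ Set.Ioo S (R ^ 2) ∧ -ε < (R ^ 2)⁻¹ / D + (-D⁻¹) * ρ⁻¹ := by
    have hcont : ContinuousAt (fun ρ : ℝ => (R ^ 2)⁻¹ / D + (-D⁻¹) * ρ⁻¹) (R ^ 2) :=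
      continuousAt_const.add (continuousAt_const.mul (continuousAt_inv₀ (by positivity)))
    have h1 : ∀ᶠ ρ in 𝓝[<] (R ^ 2), -ε < (R ^ 2)⁻¹ / D + (-D⁻¹) * ρ⁻¹ := by
      refine nhdsWithin_le_nhds (hcont.eventually (lt_mem_nhds ?_))
      have : (R ^ 2)⁻¹ / D + (-D⁻¹) * (R ^ 2)⁻¹ = 0 := by ring
      linarith
    exact (Filter.Eventually.and (Ioo_mem_nhdsLT hSR) h1).exists
  have hρ0 : 0 < ρ := hS0.trans hSρ
  have hline : ∀ t, enormQ (qLine a (q - a) t - a) ^ 2 = S * ‖t - 0‖ ^ 2 + 0 := fun t => by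
    simp [hS, enormQ_sq, qLine, mul_pow, Finset.sum_mul]
  set N : ℍ → ℝ := fun t => S * ‖t - 0‖ ^ 2 + 0 with hN
  have hNc : Continuous N := (contDiff_mul_norm_sub_sq_add S 0 0).continuous
  have hball : ∀ t, N t ≤ ρ → qLine a (q - a) t ∈ Ω := fun t ht => by
    refine hΩ (lt_of_pow_lt_pow_left₀ 2 hR.le ?_)
    rw [hline]
    exact ht.trans_lt hρR
  have hcomp : IsCompact {t | r ^ 2 ≤ N t ∧ N t ≤ ρ} := by
    refine (isCompact_closedBall (0 : ℍ) (Real.sqrt (ρ / S))).of_isClosed_subset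
      ((isClosed_le continuous_const hNc).inter (isClosed_le hNc continuous_const))
      fun t ht => ?_
    rw [mem_closedBall_zero_iff]
    refine Real.le_sqrt_of_sq_le ?_
    rw [le_div_iff₀ hS0, mul_comm]
    simpa [hN] using ht.2
  have hopen : IsOpen {t | r ^ 2 < N t ∧ N t < ρ} :=
    (isOpen_lt continuous_const hNc).inter (isOpen_lt hNc continuous_const)
  have hsub := hv.2.2 a (q - a)
  have hN0 : ∀ t, r ^ 2 ≤ N t → N t ≠ 0 := fun t ht =>
    ((by positivity : 0 < r ^ 2).trans_le ht).ne'
  have key := le_of_harmonicBoundAt (w := fun t => v (qLine a (q - a) t))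
    (h := fun t => ((R ^ 2)⁻¹ / D + ε) + (-D⁻¹) * (N t)⁻¹) hcomp hopen
    (fun t ht => ⟨ht.1.le, ht.2.le⟩) (hsub.1.mono fun t ht => hball t ht.2)
    (fun t ht => hsub.2.1 t (hball t ht.2))
    (continuousOn_const.add (continuousOn_const.mul
      (hNc.continuousOn.inv₀ fun t ht => hN0 t ht.1)))
    ⟨fun t ht => (contDiffAt_const.add (contDiffAt_const.mul
        (contDiffAt_inv_norm_sub_sq (hN0 t ht.1.le)))).contDiffWithinAt,
      fun t ht => by
        rw [lapQ_const_sub_mul_inv _ _ (hN0 t ht.1.le)]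
        simp⟩
    (fun t ht => by
      refine Eventually.frequently ?_
      filter_upwards [eventually_mem_nhdsWithin,
        nhdsWithin_le_nhds (eventually_closedBall_subset (hopen.mem_nhds ht))] with s hs hsV
      exact hsub.harmonicBoundAt hs fun y hy => hball y (hsV hy).2.le)
    (fun t ht => by
      obtain ⟨⟨h1, h2⟩, h3⟩ := ht
      rcases h1.eq_or_lt with h1 | h1
      · refine (hv1 _ ((sq_le_sq₀ (enormQ_nonneg _) hr.le).1 ?_)).trans ?_
        · rw [hline]
          exact h1.ge
        · change ((-1 : ℝ) : EReal) ≤ _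
          rw [EReal.coe_le_coe_iff, ← h1]
          have : (R ^ 2)⁻¹ / D + (-D⁻¹) * (r ^ 2)⁻¹ = -1 := by
            have h4 : (R ^ 2)⁻¹ / D + (-D⁻¹) * (r ^ 2)⁻¹ = -(((r ^ 2)⁻¹ - (R ^ 2)⁻¹) * D⁻¹) := by
              ring
            rw [h4, ← hD, mul_inv_cancel₀ hD0.ne']
          linarith
      · have h2 : N t = ρ := h2.eq_or_lt.resolve_right fun h => h3 ⟨h1, h⟩
        refine (hv0 _ (hball t h2.le)).trans ?_
        change ((0 : ℝ) : EReal) ≤ _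
        rw [EReal.coe_le_coe_iff, h2]
        linarith)
    1 ⟨by simpa [hN] using hlt.le, by simpa [hN] using hSρ.le⟩
  have h1 : qLine a (q - a) 1 = q := by
    ext1 k
    simp [qLine]
  rw [h1] at key
  refine key.trans_eq ?_
  have hN1 : N 1 = S := by simp [hN]
  rw [ballExt, max_eq_left hlt.le, hN1, ← hD]
  congr 1
  ring

end Balls

section RelativeExtremal

variable {n : ℕ}

lemma QPSH.div_const {u : Hn n → EReal} {Ω : Set (Hn n)} (hu : QPSH u Ω) {C : ℝ} (hC : 0 < C) :
    QPSH (fun q => u q / C) Ω := by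
  have hC0 : (0 : EReal) < C := EReal.coe_pos.2 hC
  have hCt : (C : EReal) ≠ ⊤ := EReal.coe_ne_top C
  have husc : ∀ {X : Type} [TopologicalSpace X] {f : X → EReal} {s : Set X},
      UpperSemicontinuousOn f s → UpperSemicontinuousOn (fun x => f x / C) s := by
    intro X _ f s hf x hx y hy
    filter_upwards [hf x hx (y * C) ((EReal.div_lt_iff hC0 hCt).1 hy)] with z hz
    exact (EReal.div_lt_iff hC0 hCt).2 hz
  have htop : ∀ x : EReal, x ≠ ⊤ → x / C ≠ ⊤ := fun x hx => by
    rw [← lt_top_iff_ne_top] at hx ⊢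
    rwa [EReal.div_lt_iff hC0 hCt, EReal.top_mul_coe_of_pos hC]
  refine ⟨husc hu.1, fun q hq => htop _ (hu.2.1 q hq), fun a b => ?_⟩
  obtain ⟨h1, h2, h3⟩ := hu.2.2 a b
  refine ⟨husc h1, fun t ht => htop _ (h2 t ht), fun x r hr hs h hc hh hle y hy => ?_⟩
  rw [EReal.div_le_iff_le_mul hC0 hCt, ← EReal.coe_mul]
  refine h3 x r hr hs (fun z => C * h z) (continuousOn_const.mul hc)
    (hh.const_mul Metric.isOpen_ball C) (fun z hz => ?_) y hy
  rw [EReal.coe_mul, ← EReal.div_le_iff_le_mul hC0 hCt]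
  exact hle z hz

lemma QPSH.translate_sub_const {u : Hn n → EReal} {Ω : Set (Hn n)} (hu : QPSH u Ω) (p : Hn n)
    (ε : ℝ) : QPSH (fun q => u (q + p) - ε) {q | q + p ∈ Ω} := by
  have hlt : ∀ x y : EReal, x - ε < y ↔ x < y + ε := fun x y =>
    EReal.sub_lt_iff (.inl (EReal.coe_ne_bot ε)) (.inl (EReal.coe_ne_top ε))
  have hle : ∀ x y : EReal, x - ε ≤ y ↔ x ≤ y + ε := fun x y =>
    EReal.sub_le_iff_le_add (.inl (EReal.coe_ne_bot ε)) (.inl (EReal.coe_ne_top ε))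
  have husc : UpperSemicontinuousOn (fun q => u (q + p) - ε) {q | q + p ∈ Ω} := by
    have h := hu.1.comp (g := fun q => q + p) (t := {q | q + p ∈ Ω})
      (continuous_id.add continuous_const).continuousOn fun q hq => hq
    intro q hq y hy
    filter_upwards [h q hq (y + ε) ((hlt _ _).1 hy)] with z hz
    exact (hlt _ _).2 hz
  have htop : ∀ q, q + p ∈ Ω → u (q + p) - ε ≠ ⊤ := fun q hq => by
    have := hu.2.1 _ hq
    rw [← lt_top_iff_ne_top] at this ⊢
    rwa [hlt, EReal.top_add_coe]
  refine ⟨husc, htop, fun a b => ⟨?_, fun t ht => htop _ ht, ?_⟩⟩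
  · exact husc.comp (continuous_qLine a b).continuousOn fun t ht => ht
  · have hline : ∀ t, qLine a b t + p = qLine (a + p) b t := fun t => by
      ext1 k
      simp only [qLine, Pi.add_apply]
      abel
    intro x r hr hs h hc hh hbd y hy
    rw [hle, hline, ← EReal.coe_add]
    refine (hu.2.2 (a + p) b).2.2 x r hr (fun t ht => ?_) (fun z => h z + ε)
      (hc.add continuousOn_const) (hh.add_const Metric.isOpen_ball ε) (fun z hz => ?_) y hy
    · have := hs ht
      rwa [Set.mem_ofPred_eq, Set.mem_ofPred_eq, hline] at this
    · have := hbd z hz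
      rwa [hle, hline, ← EReal.coe_add] at this

open Classical in
/-- Gluing of plurisubharmonic functions. -/
lemma QPSH.glue {w u : Hn n → EReal} {U Ω : Set (Hn n)} (hU : IsOpen U)
    (hw : QPSH w U) (hu : QPSH u Ω) {c : EReal} (hwc : ∀ q ∈ U, w q ≤ c)
    (huc : ∀ q ∈ Ω, q ∉ U → c < u q) :
    QPSH (fun q => if q ∈ U then max (w q) (u q) else u q) Ω := by
  set W : Hn n → EReal := fun q => if q ∈ U then max (w q) (u q) else u q with hW
  have huW : ∀ q, u q ≤ W q := fun q => by
    simp only [hW]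
    split_ifs
    exacts [le_max_right _ _, le_rfl]
  have hwW : ∀ q ∈ U, w q ≤ W q := fun q hq => by
    simp only [hW, if_pos hq]
    exact le_max_left _ _
  have husc : UpperSemicontinuousOn W Ω := by
    intro q hq y hy
    have huy := hu.1 q hq y ((huW q).trans_lt hy)
    by_cases hqU : q ∈ U
    · have hwy := hw.1 q hqU y ((hwW q hqU).trans_lt hy)
      rw [hU.nhdsWithin_eq hqU] at hwy
      filter_upwards [huy, nhdsWithin_le_nhds hwy] with z h1 h2
      simp only [hW]
      split_ifs
      exacts [max_lt h2 h1, h1]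
    · have hcy : c < y := (huc q hq hqU).trans_le ((huW q).trans hy.le)
      filter_upwards [huy] with z h1
      simp only [hW]
      split_ifs with hz
      exacts [max_lt ((hwc z hz).trans_lt hcy) h1, h1]
  have htop : ∀ q ∈ Ω, W q ≠ ⊤ := fun q hq => by
    rw [← lt_top_iff_ne_top]
    simp only [hW]
    split_ifs with hqU
    exacts [max_lt (hw.2.1 q hqU).lt_top (hu.2.1 q hq).lt_top, (hu.2.1 q hq).lt_top]
  refine ⟨husc, htop, fun a b => subharmonicOn_of_harmonicBoundAt
    (husc.comp (continuous_qLine a b).continuousOn fun t ht => ht)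
    (fun t ht => htop _ ht) fun t _ hnhds => Eventually.frequently ?_⟩
  by_cases hWu : W (qLine a b t) = u (qLine a b t)
  · filter_upwards [eventually_mem_nhdsWithin,
      nhdsWithin_le_nhds (eventually_closedBall_subset hnhds)] with r hr hs h hc hh hle
    exact hWu.trans_le ((hu.2.2 a b).harmonicBoundAt hr hs h hc hh
      fun y hy => (huW _).trans (hle y hy))
  · have htU : qLine a b t ∈ U := by
      by_contra hn
      exact hWu (if_neg hn)
    have hWw : W (qLine a b t) = w (qLine a b t) := by
      have hmax : W (qLine a b t) = max (w (qLine a b t)) (u (qLine a b t)) := if_pos htU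
      rcases max_choice (w (qLine a b t)) (u (qLine a b t)) with h | h
      exacts [hmax.trans h, absurd (hmax.trans h) hWu]
    filter_upwards [eventually_mem_nhdsWithin, nhdsWithin_le_nhds (eventually_closedBall_subset
      ((hU.preimage (continuous_qLine a b)).mem_nhds htU))] with r hr hs h hc hh hle
    exact hWw.trans_le ((hw.2.2 a b).harmonicBoundAt hr hs h hc hh
      fun y hy => (hwW _ (hs (Metric.sphere_subset_closedBall hy))).trans (hle y hy))

lemma le_relExt {Ω K : Set (Hn n)} {u : Hn n → EReal} (hu : QPSH u Ω) (h0 : ∀ x ∈ Ω, u x ≤ 0)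
    (h1 : ∀ x ∈ K, u x ≤ -1) (q : Hn n) : u q ≤ relExt Ω K q :=
  le_sSup ⟨u, hu, h0, h1, rfl⟩

lemma relExt_le {Ω K : Set (Hn n)} {q : Hn n} {y : EReal}
    (h : ∀ u : Hn n → EReal, QPSH u Ω → (∀ x ∈ Ω, u x ≤ 0) → (∀ x ∈ K, u x ≤ -1) → u q ≤ y) :
    relExt Ω K q ≤ y :=
  sSup_le fun _ ⟨u, hu, h0, h1, hy⟩ => hy.trans_le (h u hu h0 h1)

lemma relExt_nonpos {Ω K : Set (Hn n)} {q : Hn n} (hq : q ∈ Ω) : relExt Ω K q ≤ 0 :=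
  relExt_le fun _ _ h0 _ => h0 q hq

lemma neg_one_le_relExt (Ω K : Set (Hn n)) (q : Hn n) : -1 ≤ relExt Ω K q :=
  le_relExt (u := fun _ => ((-1 : ℝ) : EReal)) (qpsh_const (-1) Ω)
    (fun _ _ => by norm_cast) (fun _ _ => le_rfl) q

lemma coe_toReal_relExt {Ω K : Set (Hn n)} {q : Hn n} (hq : q ∈ Ω) :
    ((relExt Ω K q).toReal : EReal) = relExt Ω K q :=
  EReal.coe_toReal ((relExt_nonpos hq).trans_lt EReal.zero_lt_top).ne
    ((EReal.bot_lt_coe (-1)).trans_le (neg_one_le_relExt Ω K q)).ne'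

lemma relExt_le_ballExt {Ω K : Set (Hn n)} {a : Hn n} {r R : ℝ} (hr : 0 < r) (hrR : r < R)
    (hK : eClosedBall a r ⊆ K) (hΩ : eBall a R ⊆ Ω) {q : Hn n} (hq : q ∈ eBall a R) :
    relExt Ω K q ≤ (ballExt a r R q : EReal) :=
  relExt_le fun _ hu h0 h1 => hu.le_ballExt hr hrR hΩ h0 (fun x hx => h1 x (hK hx)) hq

lemma relExt_eBall {a : Hn n} {r R : ℝ} (hr : 0 < r) (hrR : r < R) {q : Hn n}
    (hq : q ∈ eBall a R) :
    relExt (eBall a R) (eClosedBall a r) q = (ballExt a r R q : EReal) := by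
  refine (relExt_le_ballExt hr hrR le_rfl le_rfl hq).antisymm
    (le_relExt (qpsh_ballExt a hr hrR _)
      (fun x hx => EReal.coe_nonpos.2 (ballExt_nonpos hr hrR hx)) (fun x hx => ?_) q)
  rw [ballExt_of_le hr hrR ((sq_le_sq₀ (enormQ_nonneg _) hr.le).2 hx)]
  rfl

lemma exists_eBall_subset {Ω K : Set (Hn n)} (hΩ : IsOpen Ω) (hK : IsCompact K) (hKΩ : K ⊆ Ω)
    {a : Hn n} {r : ℝ} (hr : 0 < r) (ha : eClosedBall a r ⊆ K) : ∃ R, r < R ∧ eBall a R ⊆ Ω := by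
  obtain ⟨δ, hδ, hsub⟩ := hK.exists_thickening_subset_open hΩ hKΩ
  refine ⟨r + δ, by linarith, fun q hq => ?_⟩
  set m := enormQ (q - a) with hm
  have hmR : m < r + δ := hq
  rcases le_or_gt m r with hle | hlt
  · exact hKΩ (ha hle)
  have hm0 : 0 < m := hr.trans hlt
  refine hsub (Metric.mem_thickening_iff.2 ⟨a + (r / m) • (q - a), ha ?_, ?_⟩)
  · change enormQ (a + (r / m) • (q - a) - a) ≤ r
    rw [add_sub_cancel_left, enormQ_smul, ← hm, abs_of_pos (by positivity),
      div_mul_cancel₀ _ hm0.ne']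
  · have heq : q - (a + (r / m) • (q - a)) = (1 - r / m) • (q - a) := by
      rw [sub_smul, one_smul]
      abel
    have hrm : r / m ≤ 1 := (div_le_one hm0).2 hlt.le
    rw [dist_eq_norm, heq]
    refine (norm_le_enormQ _).trans_lt ?_
    rw [enormQ_smul, ← hm, abs_of_nonneg (sub_nonneg.2 hrm), sub_mul, div_mul_cancel₀ _ hm0.ne']
    linarith

/-- The relatively extremal function of a union of closed balls attains its boundary value `-1`
continuously. -/
lemma eventually_relExt_le {Ω K : Set (Hn n)} (hΩ : IsOpen Ω) (hK : IsCompact K) (hKΩ : K ⊆ Ω)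
    {a : Hn n} {r : ℝ} (hr : 0 < r) (ha : eClosedBall a r ⊆ K) {k : Hn n}
    (hk : k ∈ eClosedBall a r) {ε : ℝ} (hε : 0 < ε) :
    ∀ᶠ q in 𝓝 k, relExt Ω K q ≤ ((-1 + ε : ℝ) : EReal) := by
  obtain ⟨R, hrR, hR⟩ := exists_eBall_subset hΩ hK hKΩ hr ha
  have hcont : Continuous fun q : Hn n => enormQ (q - a) :=
    continuous_enormQ.comp (continuous_id.sub continuous_const)
  have hkR : enormQ (k - a) < R := lt_of_le_of_lt hk hrR
  have hkv : ballExt a r R k < -1 + ε := by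
    rw [ballExt_of_le hr hrR ((sq_le_sq₀ (enormQ_nonneg _) hr.le).2 hk)]
    linarith
  filter_upwards [hcont.continuousAt.eventually (gt_mem_nhds hkR),
    (continuous_ballExt a hr R).continuousAt.eventually (gt_mem_nhds hkv)] with q hq hqv
  exact (relExt_le_ballExt hr hrR ha hR hq).trans (EReal.coe_le_coe_iff.2 hqv.le)

/-- The exhaustion function of a hyperconvex domain may be normalized on a compact subset. -/
lemma QHyperconvex.exists_le_neg_one {Ω K : Set (Hn n)} (hΩ : QHyperconvex Ω) (hK : IsCompact K)
    (hKΩ : K ⊆ Ω) : ∃ ρ : Hn n → EReal, QPSH ρ Ω ∧ (∀ q ∈ Ω, ρ q < 0) ∧ (∀ q ∈ K, ρ q ≤ -1) ∧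
      ∀ c : ℝ, c < 0 → ∃ L, IsCompact L ∧ L ⊆ Ω ∧ ∀ q ∈ Ω, q ∉ L → (c : EReal) ≤ ρ q := by
  obtain ⟨-, -, -, ρ, hρ, hρ0, hρc⟩ := hΩ
  obtain ⟨C, hC, hCK⟩ : ∃ C : ℝ, 0 < C ∧ ∀ q ∈ K, ρ q ≤ ((-C : ℝ) : EReal) := by
    rcases K.eq_empty_or_nonempty with rfl | hne
    · exact ⟨1, one_pos, by simp⟩
    obtain ⟨k, hkK, hk⟩ := (hρ.1.mono hKΩ).exists_isMaxOn hne hK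
    obtain ⟨z, hkz, hz⟩ := EReal.lt_iff_exists_real_btwn.1 (hρ0 k (hKΩ hkK))
    have hz0 : z < 0 := by exact_mod_cast hz
    refine ⟨-z, neg_pos.2 hz0, fun q hq => ?_⟩
    rw [neg_neg]
    exact (hk hq).trans hkz.le
  have hC0 : (0 : EReal) < C := EReal.coe_pos.2 hC
  have hCt : (C : EReal) ≠ ⊤ := EReal.coe_ne_top C
  refine ⟨fun q => ρ q / C, hρ.div_const hC, fun q hq => ?_, fun q hq => ?_, fun c hc => ?_⟩
  · rw [EReal.div_lt_iff hC0 hCt, zero_mul]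
    exact hρ0 q hq
  · rw [EReal.div_le_iff_le_mul hC0 hCt, mul_neg_one]
    exact hCK q hq
  · obtain ⟨hL, hLΩ⟩ := hρc (c * C) (mul_neg_of_neg_of_pos hc hC)
    refine ⟨_, hL, hLΩ, fun q hq hqL => ?_⟩
    rw [EReal.le_div_iff_mul_le hC0 hCt, ← EReal.coe_mul]
    by_contra! hlt
    exact hqL (subset_closure ⟨hq, hlt⟩)

lemma relExt_le_add {Ω K : Set (Hn n)} (hΩ : QHyperconvex Ω) (hK : IsCompact K) (hKΩ : K ⊆ Ω)
    (hlim : ∀ ε : ℝ, 0 < ε → ∀ k ∈ K, ∀ᶠ q in 𝓝 k, relExt Ω K q ≤ ((-1 + ε : ℝ) : EReal))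
    {ε : ℝ} (hε : 0 < ε) : ∃ δ > 0, ∀ q ∈ Ω, ∀ p, q + p ∈ Ω → ‖p‖ < δ →
      relExt Ω K (q + p) ≤ relExt Ω K q + ε := by
  classical
  have hopen := hΩ.1
  obtain ⟨ρ, hρ, hρ0, hρK, hρc⟩ := hΩ.exists_le_neg_one hK hKΩ
  obtain ⟨L, hL, hLΩ, hρL⟩ := hρc (-(ε / 2)) (by linarith)
  obtain ⟨δ₁, hδ₁, hsub₁⟩ := hL.exists_thickening_subset_open hopen hLΩ
  set A : Set (Hn n) := {q | relExt Ω K q ≤ ((-1 + ε : ℝ) : EReal)}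
  have hKA : K ⊆ interior A := fun k hk => mem_interior_iff_mem_nhds.2 (hlim ε hε k hk)
  obtain ⟨δ₂, hδ₂, hsub₂⟩ := hK.exists_thickening_subset_open
    (hopen.inter isOpen_interior) (Set.subset_inter hKΩ hKA)
  refine ⟨min δ₁ δ₂, lt_min hδ₁ hδ₂, fun q hq p hqp hp => ?_⟩
  have hthick : ∀ {δ : ℝ} {A : Set (Hn n)} {x : Hn n}, ‖p‖ < δ → x ∈ A →
      x + p ∈ Metric.thickening δ A := fun hpδ hx =>
    Metric.mem_thickening_iff.2 ⟨_, hx, by simpa [dist_eq_norm] using hpδ⟩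
  refine relExt_le fun v hv hv0 hv1 => ?_
  have hle : ∀ x y : EReal, x - ε ≤ y ↔ x ≤ y + ε := fun x y =>
    EReal.sub_le_iff_le_add (.inl (EReal.coe_ne_bot ε)) (.inl (EReal.coe_ne_top ε))
  set U : Set (Hn n) := {x | x + p ∈ Ω}
  have hglue := QPSH.glue (U := U) (c := ((-ε : ℝ) : EReal))
    (hopen.preimage (continuous_id.add continuous_const)) (hv.translate_sub_const p ε) hρ
    (fun x hx => by
      rw [hle, ← EReal.coe_add, neg_add_cancel]
      exact hv0 _ hx)
    (fun x hx hxU => by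
      refine (EReal.coe_lt_coe_iff.2 (by linarith : -ε < -(ε / 2))).trans_le (hρL x hx ?_)
      exact fun hxL => hxU (hsub₁ (hthick (hp.trans_le (min_le_left _ _)) hxL)))
  have key := le_relExt (K := K) hglue
    (fun x hx => by
      split_ifs with hxU
      · refine max_le ?_ (hρ0 x hx).le
        rw [hle, zero_add]
        exact (hv0 _ hxU).trans (EReal.coe_nonneg.2 hε.le)
      · exact (hρ0 x hx).le)
    (fun x hx => by
      split_ifs with hxU
      · refine max_le ?_ (hρK x hx)
        have hxA : x + p ∈ A :=
          interior_subset (hsub₂ (hthick (hp.trans_le (min_le_right _ _)) hx)).2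
        rw [hle]
        exact (le_relExt hv hv0 hv1 _).trans hxA
      · exact hρK x hx) q
  rw [if_pos (show q ∈ U from hqp)] at key
  exact (hle _ _).1 ((le_max_left _ _).trans key)

lemma continuousOn_relExt {Ω K : Set (Hn n)} (hΩ : QHyperconvex Ω) (hK : IsCompact K)
    (hKΩ : K ⊆ Ω)
    (hlim : ∀ ε : ℝ, 0 < ε → ∀ k ∈ K, ∀ᶠ q in 𝓝 k, relExt Ω K q ≤ ((-1 + ε : ℝ) : EReal)) :
    ContinuousOn (relExt Ω K) Ω := by
  have h : ContinuousOn (fun q => (relExt Ω K q).toReal) Ω := by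
    rw [Metric.continuousOn_iff]
    intro q hq ε hε
    obtain ⟨δ, hδ, hle⟩ := relExt_le_add hΩ hK hKΩ hlim (half_pos hε)
    have hdist : ∀ x ∈ Ω, ∀ y ∈ Ω, dist x y < δ →
        (relExt Ω K x).toReal ≤ (relExt Ω K y).toReal + ε / 2 := fun x hx y hy hxy => by
      have := hle y hy (x - y) (by rwa [add_sub_cancel]) (by rwa [← dist_eq_norm])
      rw [add_sub_cancel, ← coe_toReal_relExt hx, ← coe_toReal_relExt hy,
        ← EReal.coe_add] at this
      exact EReal.coe_le_coe_iff.1 this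
    refine ⟨δ, hδ, fun x hx hxq => ?_⟩
    have h1 := hdist x hx q hq hxq
    have h2 := hdist q hq x hx (by rwa [dist_comm])
    rw [Real.dist_eq, abs_lt]
    constructor <;> linarith
  exact (continuous_coe_real_ereal.comp_continuousOn h).congr fun q hq =>
    (coe_toReal_relExt hq).symm

end RelativeExtremal

/-- **Corollary 3.1.**  If `K ⊆ Ω` is compact and a union of closed balls, then
`u_{K,Ω} = u*_{K,Ω}` is continuous in `Ω`; moreover for concentric balls the relatively
extremal function is given by the explicit formula. -/
theorem relExt_of_union_of_balls {n : ℕ} (Ω K : Set (Hn n)) (hΩ : QHyperconvex Ω)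
    (hK : IsCompact K) (hKΩ : K ⊆ Ω)
    (hballs : ∃ (ι : Type) (c : ι → Hn n) (r : ι → ℝ),
      (∀ i, 0 < r i) ∧ K = ⋃ i, eClosedBall (c i) (r i)) :
    ((∀ q ∈ Ω, relExt Ω K q = uscReg (relExt Ω K) Ω q) ∧
      ContinuousOn (relExt Ω K) Ω) ∧
    (∀ (a : Hn n) (r R : ℝ), 0 < r → r < R →
      (∀ q ∈ eBall a R, q ≠ a →
        relExt (eBall a R) (eClosedBall a r) q =
          ((max (-1) ((R ^ (-2 : ℤ) - enormQ (q - a) ^ (-2 : ℤ)) /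
            (r ^ (-2 : ℤ) - R ^ (-2 : ℤ))) : ℝ) : EReal)) ∧
      relExt (eBall a R) (eClosedBall a r) a = -1) := by
  refine ⟨?_, fun a r R hr hrR => ⟨fun q hq hqa => ?_, ?_⟩⟩
  · have hcont : ContinuousOn (relExt Ω K) Ω := by
      obtain ⟨ι, c, r, hr, hKu⟩ := hballs
      refine continuousOn_relExt hΩ hK hKΩ fun ε hε k hk => ?_
      obtain ⟨i, hi⟩ := Set.mem_iUnion.1 (hKu ▸ hk)
      exact eventually_relExt_le hΩ.1 hK hKΩ (hr i)
        (hKu ▸ Set.subset_iUnion (fun i => eClosedBall (c i) (r i)) i) hi hε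
    refine ⟨fun q hq => ?_, hcont⟩
    have : (𝓝[Ω] q).NeBot := mem_closure_iff_nhdsWithin_neBot.1 (subset_closure hq)
    exact (Filter.Tendsto.limsup_eq (hcont q hq)).symm
  · rw [relExt_eBall hr hrR hq, ballExt_eq hr hrR hqa]
  · have ha : enormQ (a - a) = 0 := by rw [sub_self, enormQ_zero]
    rw [relExt_eBall hr hrR (ha.trans_lt (hr.trans hrR)), ballExt_of_le hr hrR]
    · rfl
    · exact ha ▸ (sq_le_sq₀ le_rfl hr.le).2 hr.le

end
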